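/- arXiv:2211.03833 — 5 statements merged into one kernel-verified Lean document; each statement's English description precedes it below -/
import Mathlib

section
/- For all g, u ∈ {1, …, N} with g ≠ u, the following sums vanish: Σ_{k=1}^{N} q^{−2k} (R^{t₂})^{gg}_{kk} · ((R₂₁⁻¹)^{t₁})^{kk}_{uu} = 0 and Σ_{k=1}^{N} q^{−2k} ((R₂₁⁻¹)^{t₂})^{gg}_{kk} · (R^{t₁})^{kk}_{uu} = 0. -/
open scoped BigOperators TensorProduct

noncomputable section

abbrev K : Type := RatFunc ℂ

def q : K := RatFunc.X

/-- The standard R-matrix of `U_q(gl_N)`: the coefficient of `e_{ik} ⊗ e_{jl}` is the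
entry at row `(i,j)`, column `(k,l)`. -/
def Rmat (N : ℕ) : Matrix (Fin N × Fin N) (Fin N × Fin N) K :=
  Matrix.of fun p c =>
    if p.1 = c.1 ∧ p.2 = c.2 then (if p.1 = p.2 then q else 1)
    else if p.1 = c.2 ∧ p.2 = c.1 ∧ c.1 < p.1 then q - q⁻¹
    else 0

/-- partial transpose in the first tensor factor -/
def pt1 {N : ℕ} {α : Type} (C : Matrix (Fin N × Fin N) (Fin N × Fin N) α) :
    Matrix (Fin N × Fin N) (Fin N × Fin N) α :=
  Matrix.of fun p c => C (c.1, p.2) (p.1, c.2)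

/-- partial transpose in the second tensor factor -/
def pt2 {N : ℕ} {α : Type} (C : Matrix (Fin N × Fin N) (Fin N × Fin N) α) :
    Matrix (Fin N × Fin N) (Fin N × Fin N) α :=
  Matrix.of fun p c => C (p.1, c.2) (c.1, p.2)

/-- flip of the two tensor factors -/
def flip21 {N : ℕ} {α : Type} (C : Matrix (Fin N × Fin N) (Fin N × Fin N) α) :
    Matrix (Fin N × Fin N) (Fin N × Fin N) α :=
  Matrix.of fun p c => C (p.2, p.1) (c.2, c.1)

theorem q_ne_zero : q ≠ 0 := RatFunc.X_ne_zero

/-- The matrix obtained from `flip21 (Rmat N)` by replacing `q` with `q⁻¹`. -/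
def flipInv (N : ℕ) : Matrix (Fin N × Fin N) (Fin N × Fin N) K :=
  Matrix.of fun p c =>
    if p.1 = c.1 ∧ p.2 = c.2 then (if p.1 = p.2 then q⁻¹ else 1)
    else if p.1 = c.2 ∧ p.2 = c.1 ∧ p.1 < c.1 then q⁻¹ - q
    else 0

theorem flip21_Rmat_apply {N : ℕ} (p c : Fin N × Fin N) :
    flip21 (Rmat N) p c =
      (if c = p then (if p.1 = p.2 then q else 1) else 0) +
        (if c = p.swap then (if p.1 < p.2 then q - q⁻¹ else 0) else 0) := by
  obtain ⟨i, j⟩ := p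
  obtain ⟨k, l⟩ := c
  simp only [flip21, Rmat, Matrix.of_apply, Prod.mk.injEq, Prod.swap_prod_mk]
  grind

theorem flip21_Rmat_mul_flipInv (N : ℕ) : flip21 (Rmat N) * flipInv N = 1 := by
  have hq := mul_inv_cancel₀ q_ne_zero
  ext p c
  rw [Matrix.mul_apply]
  simp only [flip21_Rmat_apply, add_mul, ite_mul, zero_mul, Finset.sum_add_distrib,
    Finset.sum_ite_eq', Finset.mem_univ, if_true]
  obtain ⟨i, j⟩ := p
  obtain ⟨k, l⟩ := c
  simp only [flipInv, Matrix.of_apply, Matrix.one_apply, Prod.mk.injEq, Prod.swap_prod_mk]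
  grind

theorem flip21_Rmat_inv (N : ℕ) : (flip21 (Rmat N))⁻¹ = flipInv N :=
  Matrix.inv_eq_right_inv (flip21_Rmat_mul_flipInv N)

theorem Rmat_swap {N : ℕ} (i k : Fin N) :
    Rmat N (i, k) (k, i) = if k = i then q else if k < i then q - q⁻¹ else 0 := by
  simp only [Rmat, Matrix.of_apply]
  grind

theorem flipInv_swap {N : ℕ} (i k : Fin N) :
    flipInv N (i, k) (k, i) = if k = i then q⁻¹ else if i < k then q⁻¹ - q else 0 := by
  simp only [flipInv, Matrix.of_apply]
  grind

theorem q_zpow_neg_two_mul (k : ℕ) : q ^ (-(2 : ℤ) * ((k : ℕ) + 1)) = (q⁻¹ ^ 2) ^ (k + 1) := by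
  rw [← pow_mul, inv_pow, ← zpow_natCast, ← zpow_neg]
  congr 1

theorem sum_range_Rmat_swap_mul_flipInv_swap {a b : ℕ} (hab : a ≠ b) (n : ℕ) :
    ∑ k ∈ Finset.range n, (q⁻¹ ^ 2) ^ (k + 1) *
        (if k = a then q else if k < a then q - q⁻¹ else 0) *
        (if k = b then q⁻¹ else if b < k then q⁻¹ - q else 0) =
      if b < n ∧ n ≤ a then (1 - q⁻¹ ^ 2) * (q⁻¹ ^ 2) ^ n else 0 := by
  have hq := mul_inv_cancel₀ q_ne_zero
  induction n with
  | zero => simp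
  | succ n ih =>
    rw [Finset.sum_range_succ, ih, pow_succ]
    generalize (q⁻¹ ^ 2) ^ n = y
    split_ifs <;> first | omega | grind

theorem sum_Rmat_swap_mul_flipInv_swap {N : ℕ} {a b : Fin N} (hab : a ≠ b) :
    ∑ k : Fin N, q ^ (-(2 : ℤ) * ((k : ℕ) + 1)) * Rmat N (a, k) (k, a) *
      flipInv N (b, k) (k, b) = 0 := by
  have h := sum_range_Rmat_swap_mul_flipInv_swap (Fin.val_ne_of_ne hab) N
  rw [if_neg (by omega), Finset.sum_range] at h
  rw [← h]
  refine Finset.sum_congr rfl fun k _ => ?_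
  simp only [q_zpow_neg_two_mul, Rmat_swap, flipInv_swap, Fin.ext_iff, Fin.lt_def]

theorem stmt2 (N : ℕ) (hN : 1 ≤ N) (g u : Fin N) (hgu : g ≠ u) :
    (∑ k : Fin N, q ^ (-(2 : ℤ) * ((k : ℕ) + 1)) * pt2 (Rmat N) (g, g) (k, k) *
        pt1 ((flip21 (Rmat N))⁻¹) (k, k) (u, u)) = 0 ∧
    (∑ k : Fin N, q ^ (-(2 : ℤ) * ((k : ℕ) + 1)) * pt2 ((flip21 (Rmat N))⁻¹) (g, g) (k, k) *
        pt1 (Rmat N) (k, k) (u, u)) = 0 := by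
  rw [flip21_Rmat_inv]
  refine ⟨sum_Rmat_swap_mul_flipInv_swap hgu, ?_⟩
  rw [← sum_Rmat_swap_mul_flipInv_swap hgu.symm]
  exact Finset.sum_congr rfl fun k _ => mul_right_comm _ _ _
end
end

section
/- Let u be a dual pairing of A^op with B and let v be a dual pairing of A with B^op. Then the k-bilinear multiplication on A ⊗ B defined by (a ⊗ b)(a' ⊗ b') := Σ v(a'₍₁₎, b₍₁₎) u(a'₍₃₎, b₍₃₎) (a a'₍₂₎) ⊗ (b₍₂₎ b') is associative with unit 1 ⊗ 1; moreover a ↦ a ⊗ 1 and b ↦ 1 ⊗ b are algebra homomorphisms and (a ⊗ 1)(1 ⊗ b) = a ⊗ b for all a ∈ A, b ∈ B. Hence A ⊗ B is a twisted tensor product with twisting map τ(b ⊗ a) := Σ v(a₍₁₎, b₍₁₎) u(a₍₃₎, b₍₃₎) a₍₂₎ ⊗ b₍₂₎. -/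
open scoped BigOperators TensorProduct

noncomputable section

/-- the twofold coproduct `Δ₂ = (Δ ⊗ id) ∘ Δ : A → (A ⊗ A) ⊗ A` -/
def comul₂ (k A : Type) [CommSemiring k] [Semiring A] [Bialgebra k A] :
    A →ₗ[k] (A ⊗[k] A) ⊗[k] A :=
  (TensorProduct.map (Coalgebra.comul (R := k)) LinearMap.id).comp (Coalgebra.comul (R := k))

section Helpers

open TensorProduct Coalgebra

section Coalgebra

variable {k C : Type} [Field k] [AddCommGroup C] [Module k C] [Coalgebra k C]

/-- the left hit action `c ↦ Σ f(c₁) c₂` of a functional on a coalgebra -/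
def leftHit (f : C →ₗ[k] k) : C →ₗ[k] C :=
  (TensorProduct.lid k C).toLinearMap ∘ₗ f.rTensor C ∘ₗ comul

/-- the right hit action `c ↦ Σ c₁ f(c₂)` of a functional on a coalgebra -/
def rightHit (f : C →ₗ[k] k) : C →ₗ[k] C :=
  (TensorProduct.rid k C).toLinearMap ∘ₗ f.lTensor C ∘ₗ comul

/-- the convolution `c ↦ Σ f(c₁) g(c₂)` of two functionals on a coalgebra -/
def functionalConv (f g : C →ₗ[k] k) : C →ₗ[k] k :=
  (TensorProduct.lid k k).toLinearMap ∘ₗ TensorProduct.map f g ∘ₗ comul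

theorem leftHit_leftHit (f g : C →ₗ[k] k) (c : C) :
    leftHit g (leftHit f c) = leftHit (functionalConv f g) c := by
  let Q : C ⊗[k] (C ⊗[k] C) →ₗ[k] C :=
    (TensorProduct.lid k C).toLinearMap ∘ₗ
      TensorProduct.map f ((TensorProduct.lid k C).toLinearMap ∘ₗ g.rTensor C)
  have h1 (x : C ⊗[k] C) :
      Q (comul.lTensor C x) = leftHit g (TensorProduct.lid k C (f.rTensor C x)) := by
    induction x with
    | zero => simp
    | add x y hx hy => simp only [map_add, hx, hy]
    | tmul x y => simp [Q, leftHit]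
  have h2 (y : C ⊗[k] C) (c : C) : Q (TensorProduct.assoc k C C C (y ⊗ₜ c)) =
      TensorProduct.lid k k (TensorProduct.map f g y) • c := by
    induction y with
    | zero => simp
    | add x y hx hy => simp only [map_add, add_tmul, add_smul, hx, hy]
    | tmul x y => simpa [Q, mul_smul] using smul_comm _ _ _
  have h3 (x : C ⊗[k] C) : Q (TensorProduct.assoc k C C C (comul.rTensor C x)) =
      TensorProduct.lid k C ((functionalConv f g).rTensor C x) := by
    induction x with
    | zero => simp
    | add x y hx hy => simp only [map_add, hx, hy]
    | tmul x y => rw [LinearMap.rTensor_tmul, h2]; simp [functionalConv]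
  change leftHit g (TensorProduct.lid k C (f.rTensor C (comul c))) =
    TensorProduct.lid k C ((functionalConv f g).rTensor C (comul c))
  rw [← h1, ← h3, Coalgebra.coassoc_apply]

theorem rightHit_rightHit (f g : C →ₗ[k] k) (c : C) :
    rightHit f (rightHit g c) = rightHit (functionalConv f g) c := by
  let Q : C ⊗[k] (C ⊗[k] C) →ₗ[k] C :=
    (TensorProduct.rid k C).toLinearMap ∘ₗ
      TensorProduct.map LinearMap.id ((TensorProduct.lid k k).toLinearMap ∘ₗ TensorProduct.map f g)
  have h1 (x : C ⊗[k] C) : Q (comul.lTensor C x) =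
      TensorProduct.rid k C ((functionalConv f g).lTensor C x) := by
    induction x with
    | zero => simp
    | add x y hx hy => simp only [map_add, hx, hy]
    | tmul x y => simp [Q, functionalConv]
  have h2 (y : C ⊗[k] C) (c : C) : Q (TensorProduct.assoc k C C C (y ⊗ₜ c)) =
      g c • TensorProduct.rid k C (f.lTensor C y) := by
    induction y with
    | zero => simp
    | add x y hx hy => simp only [map_add, add_tmul, smul_add, hx, hy]
    | tmul x y => simpa [Q, mul_smul] using smul_comm _ _ _
  have h3 (x : C ⊗[k] C) : Q (TensorProduct.assoc k C C C (comul.rTensor C x)) =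
      rightHit f (TensorProduct.rid k C (g.lTensor C x)) := by
    induction x with
    | zero => simp
    | add x y hx hy => simp only [map_add, hx, hy]
    | tmul x y => rw [LinearMap.rTensor_tmul, h2]; simp [rightHit]
  change rightHit f (TensorProduct.rid k C (g.lTensor C (comul c))) =
    TensorProduct.rid k C ((functionalConv f g).lTensor C (comul c))
  rw [← h1, ← h3, Coalgebra.coassoc_apply]

theorem leftHit_rightHit (f g : C →ₗ[k] k) (c : C) :
    leftHit f (rightHit g c) = rightHit g (leftHit f c) := by
  let Q : C ⊗[k] (C ⊗[k] C) →ₗ[k] C :=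
    (TensorProduct.lid k C).toLinearMap ∘ₗ
      TensorProduct.map f ((TensorProduct.rid k C).toLinearMap ∘ₗ g.lTensor C)
  have h1 (x : C ⊗[k] C) : Q (comul.lTensor C x) =
      rightHit g (TensorProduct.lid k C (f.rTensor C x)) := by
    induction x with
    | zero => simp
    | add x y hx hy => simp only [map_add, hx, hy]
    | tmul x y => simp [Q, rightHit]
  have h2 (y : C ⊗[k] C) (c : C) : Q (TensorProduct.assoc k C C C (y ⊗ₜ c)) =
      g c • TensorProduct.lid k C (f.rTensor C y) := by
    induction y with
    | zero => simp
    | add x y hx hy => simp only [map_add, add_tmul, smul_add, hx, hy]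
    | tmul x y => simp [Q]
  have h3 (x : C ⊗[k] C) : Q (TensorProduct.assoc k C C C (comul.rTensor C x)) =
      leftHit f (TensorProduct.rid k C (g.lTensor C x)) := by
    induction x with
    | zero => simp
    | add x y hx hy => simp only [map_add, hx, hy]
    | tmul x y => rw [LinearMap.rTensor_tmul, h2]; simp [leftHit]
  change leftHit f (TensorProduct.rid k C (g.lTensor C (comul c))) =
    rightHit g (TensorProduct.lid k C (f.rTensor C (comul c)))
  rw [← h1, ← h3, Coalgebra.coassoc_apply]

theorem leftHit_counit (c : C) : leftHit (counit (R := k)) c = c := by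
  simp [leftHit]

theorem rightHit_counit (c : C) : rightHit (counit (R := k)) c = c := by
  simp [rightHit]

end Coalgebra

theorem TensorProduct.exists_sum_tmul_tmul_eq {k M N P : Type} [Field k] [AddCommGroup M]
    [Module k M] [AddCommGroup N] [Module k N] [AddCommGroup P] [Module k P]
    (x : (M ⊗[k] N) ⊗[k] P) :
    ∃ (p : ℕ) (l : Fin p → M) (m : Fin p → N) (n : Fin p → P),
      x = ∑ i, (l i ⊗ₜ[k] m i) ⊗ₜ[k] n i := by
  induction x with
  | zero => exact ⟨0, Fin.elim0, Fin.elim0, Fin.elim0, by simp⟩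
  | add x y hx hy =>
    obtain ⟨p, l, m, n, rfl⟩ := hx
    obtain ⟨q, l', m', n', rfl⟩ := hy
    exact ⟨p + q, Fin.append l l', Fin.append m m', Fin.append n n', by simp [Fin.sum_univ_add]⟩
  | tmul x y =>
    obtain ⟨p, m, n, rfl⟩ := TensorProduct.exists_sum_tmul_eq x
    exact ⟨p, m, n, fun _ => y, by simp [sum_tmul]⟩

section Bialgebra

variable {k A : Type} [Field k] [Ring A] [Bialgebra k A]

theorem comul₂_mul (a b : A) : comul₂ k A (a * b) = comul₂ k A a * comul₂ k A b := by
  have h (x y : A ⊗[k] A) : TensorProduct.map (comul (R := k)) LinearMap.id (x * y) =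
      TensorProduct.map (comul (R := k)) LinearMap.id x *
        TensorProduct.map (comul (R := k)) (LinearMap.id : A →ₗ[k] A) y :=
    map_mul (Algebra.TensorProduct.map (Bialgebra.comulAlgHom k A) (AlgHom.id k A)) x y
  simp only [comul₂, LinearMap.comp_apply, Bialgebra.comul_mul, h]

theorem comul₂_one : comul₂ k A 1 = ((1 : A) ⊗ₜ[k] (1 : A)) ⊗ₜ[k] (1 : A) := by
  simp [comul₂, Algebra.TensorProduct.one_def]

/-- the map `c ↦ Σ f(c₁) g(c₃) c₂` is the composition of the two hit actions -/
theorem lid_rid_map_comul₂ (f g : A →ₗ[k] k) (a : A) :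
    TensorProduct.rid k A (TensorProduct.map
      ((TensorProduct.lid k A).toLinearMap ∘ₗ f.rTensor A) g (comul₂ k A a)) =
    leftHit f (rightHit g a) := by
  have h (x : A ⊗[k] A) : TensorProduct.rid k A (TensorProduct.map
      ((TensorProduct.lid k A).toLinearMap ∘ₗ f.rTensor A) g
        (TensorProduct.map (comul (R := k)) LinearMap.id x)) =
      leftHit f (TensorProduct.rid k A (g.lTensor A x)) := by
    induction x with
    | zero => simp
    | add x y hx hy => simp only [map_add, hx, hy]
    | tmul x y => simp [leftHit]
  exact h (comul a)

theorem leftHit_rightHit_eq_sum (f g : A →ₗ[k] k) {a : A} {p : ℕ} {a1 a2 a3 : Fin p → A}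
    (ha : comul₂ k A a = ∑ i, (a1 i ⊗ₜ[k] a2 i) ⊗ₜ[k] a3 i) :
    leftHit f (rightHit g a) = ∑ i, (f (a1 i) * g (a3 i)) • a2 i := by
  rw [← lid_rid_map_comul₂, ha]
  simpa [mul_smul] using Finset.sum_congr rfl fun _ _ => smul_comm _ _ _

end Bialgebra

section Twist

variable {k A B : Type} [Field k] [Ring A] [Ring B]

section Mul

variable [Algebra k A] [Algebra k B]

/-- the bilinear map `(a ⊗ b') ↦ (x ⊗ y) ↦ a x ⊗ y b'` -/
def outerMul (k A B : Type) [Field k] [Ring A] [Ring B] [Algebra k A] [Algebra k B] :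
    (A ⊗[k] B) →ₗ[k] (A ⊗[k] B) →ₗ[k] (A ⊗[k] B) :=
  TensorProduct.map₂ (LinearMap.mul k A) (LinearMap.mul k B).flip

@[simp]
theorem outerMul_tmul (a x : A) (b y : B) :
    outerMul k A B (a ⊗ₜ b) (x ⊗ₜ y) = (a * x) ⊗ₜ (y * b) := by
  simp [outerMul]

/-- the multiplication on `A ⊗ B` defined by a twisting map `τ` -/
def twistedMul (τ : A →ₗ[k] B →ₗ[k] A ⊗[k] B) :
    (A ⊗[k] B) →ₗ[k] (A ⊗[k] B) →ₗ[k] (A ⊗[k] B) :=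
  TensorProduct.curry <|
    TensorProduct.lift (outerMul k A B) ∘ₗ
      (TensorProduct.lift τ.flip).lTensor (A ⊗[k] B) ∘ₗ
      (TensorProduct.tensorTensorTensorComm k A B B A).toLinearMap ∘ₗ
      (TensorProduct.comm k A B).toLinearMap.lTensor (A ⊗[k] B)

@[simp]
theorem twistedMul_tmul (τ : A →ₗ[k] B →ₗ[k] A ⊗[k] B) (a a' : A) (b b' : B) :
    twistedMul τ (a ⊗ₜ b) (a' ⊗ₜ b') = outerMul k A B (a ⊗ₜ b') (τ a' b) := by
  simp [twistedMul]

theorem outerMul_outerMul (a a' : A) (b b' : B) (w : A ⊗[k] B) :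
    outerMul k A B (a ⊗ₜ b) (outerMul k A B (a' ⊗ₜ b') w) =
      outerMul k A B ((a * a') ⊗ₜ (b' * b)) w := by
  induction w with
  | zero => simp
  | add x y hx hy => simp only [map_add, hx, hy]
  | tmul x y => simp [mul_assoc]

theorem twistedMul_assoc (τ : A →ₗ[k] B →ₗ[k] A ⊗[k] B)
    (h1 : ∀ a a' b, τ (a * a') b = twistedMul τ (τ a b) (a' ⊗ₜ 1))
    (h2 : ∀ a b b', τ a (b * b') = twistedMul τ (1 ⊗ₜ b) (τ a b')) (x y z : A ⊗[k] B) :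
    twistedMul τ (twistedMul τ x y) z = twistedMul τ x (twistedMul τ y z) := by
  induction x with
  | zero => simp
  | add x y hx hy => simp only [map_add, LinearMap.add_apply, hx, hy]
  | tmul a b =>
  induction y with
  | zero => simp
  | add x y hx hy => simp only [map_add, LinearMap.add_apply, hx, hy]
  | tmul a' b' =>
  induction z with
  | zero => simp
  | add x y hx hy => simp only [map_add, hx, hy]
  | tmul a'' b'' =>
  obtain ⟨p, x, y, hs⟩ := TensorProduct.exists_sum_tmul_eq (τ a' b)
  obtain ⟨q, z, w, ht⟩ := TensorProduct.exists_sum_tmul_eq (τ a'' b')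
  simp only [twistedMul_tmul, hs, ht, map_sum, LinearMap.sum_apply, outerMul_tmul, h1, h2,
    outerMul_outerMul]
  rw [Finset.sum_comm]
  simp

end Mul

variable [Bialgebra k A] [Bialgebra k B]

/-- the bilinear map `(a, b) ↦ Σ v(a₁, b₁) u(a₃, b₃) a₂ ⊗ b₂` -/
def pairingTwist (u v : A →ₗ[k] B →ₗ[k] k) : A →ₗ[k] B →ₗ[k] A ⊗[k] B :=
  ((TensorProduct.map₂ (TensorProduct.map₂ v (TensorProduct.mk k A B)) u).compr₂
    ((TensorProduct.rid k (A ⊗[k] B)).toLinearMap ∘ₗ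
      (TensorProduct.lid k (A ⊗[k] B)).toLinearMap.rTensor k)).compl₁₂
    (comul₂ k A) (comul₂ k B)

theorem pairingTwist_eq_sum (u v : A →ₗ[k] B →ₗ[k] k) {a : A} {b : B} {p p' : ℕ}
    {a1 a2 a3 : Fin p → A} {b1 b2 b3 : Fin p' → B}
    (ha : comul₂ k A a = ∑ i, (a1 i ⊗ₜ[k] a2 i) ⊗ₜ[k] a3 i)
    (hb : comul₂ k B b = ∑ j, (b1 j ⊗ₜ[k] b2 j) ⊗ₜ[k] b3 j) :
    pairingTwist u v a b =
      ∑ i, ∑ j, (v (a1 i) (b1 j) * u (a3 i) (b3 j)) • (a2 i ⊗ₜ[k] b2 j) := by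
  simp only [pairingTwist, LinearMap.compl₁₂_apply, LinearMap.compr₂_apply, ha, hb, map_sum,
    LinearMap.sum_apply]
  rw [Finset.sum_comm]
  simp [mul_comm, mul_smul]

theorem pairingTwist_eq_sum_left (u v : A →ₗ[k] B →ₗ[k] k) {a : A} (b : B) {p : ℕ}
    {a1 a2 a3 : Fin p → A} (ha : comul₂ k A a = ∑ i, (a1 i ⊗ₜ[k] a2 i) ⊗ₜ[k] a3 i) :
    pairingTwist u v a b =
      ∑ i, a2 i ⊗ₜ[k] leftHit (v (a1 i)) (rightHit (u (a3 i)) b) := by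
  obtain ⟨q, b1, b2, b3, hb⟩ := TensorProduct.exists_sum_tmul_tmul_eq (comul₂ k B b)
  simp only [pairingTwist_eq_sum u v ha hb, leftHit_rightHit_eq_sum _ _ hb, tmul_sum, tmul_smul]

theorem pairingTwist_eq_sum_right (u v : A →ₗ[k] B →ₗ[k] k) (a : A) {b : B} {p : ℕ}
    {b1 b2 b3 : Fin p → B} (hb : comul₂ k B b = ∑ i, (b1 i ⊗ₜ[k] b2 i) ⊗ₜ[k] b3 i) :
    pairingTwist u v a b =
      ∑ i, leftHit (v.flip (b1 i)) (rightHit (u.flip (b3 i)) a) ⊗ₜ[k] b2 i := by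
  obtain ⟨q, a1, a2, a3, ha⟩ := TensorProduct.exists_sum_tmul_tmul_eq (comul₂ k A a)
  simp only [pairingTwist_eq_sum u v ha hb, leftHit_rightHit_eq_sum _ _ ha, sum_tmul,
    LinearMap.flip_apply, smul_tmul']
  rw [Finset.sum_comm]

theorem pairingTwist_mul_left (u v : A →ₗ[k] B →ₗ[k] k)
    (hu : ∀ a a', u (a' * a) = functionalConv (u a) (u a'))
    (hv : ∀ a a', v (a * a') = functionalConv (v a) (v a')) (a a' : A) (b : B) :
    pairingTwist u v (a * a') b =
      twistedMul (pairingTwist u v) (pairingTwist u v a b) (a' ⊗ₜ 1) := by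
  obtain ⟨p, a1, a2, a3, ha⟩ := TensorProduct.exists_sum_tmul_tmul_eq (comul₂ k A a)
  obtain ⟨p', c1, c2, c3, ha'⟩ := TensorProduct.exists_sum_tmul_tmul_eq (comul₂ k A a')
  have key : pairingTwist u v (a * a') b = ∑ i, ∑ j, (a2 i * c2 j) ⊗ₜ[k]
      leftHit (v (a1 i * c1 j)) (rightHit (u (a3 i * c3 j)) b) := by
    have h : comul₂ k A (a * a') = ∑ x, (((a1 (finProdFinEquiv.symm x).1 *
        c1 (finProdFinEquiv.symm x).2) ⊗ₜ[k] (a2 (finProdFinEquiv.symm x).1 *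
        c2 (finProdFinEquiv.symm x).2)) ⊗ₜ[k] (a3 (finProdFinEquiv.symm x).1 *
        c3 (finProdFinEquiv.symm x).2)) := by
      rw [comul₂_mul, ha, ha', Finset.sum_mul_sum, ← finProdFinEquiv.sum_comp,
        Fintype.sum_prod_type]
      simp
    rw [pairingTwist_eq_sum_left u v b h, ← finProdFinEquiv.sum_comp, Fintype.sum_prod_type]
    simp
  rw [key, pairingTwist_eq_sum_left u v b ha]
  simp only [map_sum, LinearMap.sum_apply, twistedMul_tmul, pairingTwist_eq_sum_left u v _ ha',
    outerMul_tmul, mul_one, hu, hv, ← leftHit_leftHit, ← rightHit_rightHit, leftHit_rightHit]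

theorem pairingTwist_mul_right (u v : A →ₗ[k] B →ₗ[k] k)
    (hu : ∀ b b', u.flip (b * b') = functionalConv (u.flip b) (u.flip b'))
    (hv : ∀ b b', v.flip (b' * b) = functionalConv (v.flip b) (v.flip b')) (a : A) (b b' : B) :
    pairingTwist u v a (b * b') =
      twistedMul (pairingTwist u v) (1 ⊗ₜ b) (pairingTwist u v a b') := by
  obtain ⟨p, b1, b2, b3, hb⟩ := TensorProduct.exists_sum_tmul_tmul_eq (comul₂ k B b)
  obtain ⟨p', c1, c2, c3, hb'⟩ := TensorProduct.exists_sum_tmul_tmul_eq (comul₂ k B b')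
  have key : pairingTwist u v a (b * b') = ∑ i, ∑ j,
      leftHit (v.flip (b1 i * c1 j)) (rightHit (u.flip (b3 i * c3 j)) a) ⊗ₜ[k]
        (b2 i * c2 j) := by
    have h : comul₂ k B (b * b') = ∑ x, (((b1 (finProdFinEquiv.symm x).1 *
        c1 (finProdFinEquiv.symm x).2) ⊗ₜ[k] (b2 (finProdFinEquiv.symm x).1 *
        c2 (finProdFinEquiv.symm x).2)) ⊗ₜ[k] (b3 (finProdFinEquiv.symm x).1 *
        c3 (finProdFinEquiv.symm x).2)) := by
      rw [comul₂_mul, hb, hb', Finset.sum_mul_sum, ← finProdFinEquiv.sum_comp,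
        Fintype.sum_prod_type]
      simp
    rw [pairingTwist_eq_sum_right u v a h, ← finProdFinEquiv.sum_comp, Fintype.sum_prod_type]
    simp
  rw [key, pairingTwist_eq_sum_right u v a hb', Finset.sum_comm]
  simp only [map_sum, twistedMul_tmul, pairingTwist_eq_sum_right u v _ hb,
    outerMul_tmul, one_mul, hu, hv, ← leftHit_leftHit, ← rightHit_rightHit, leftHit_rightHit]

theorem pairingTwist_one_left (u v : A →ₗ[k] B →ₗ[k] k) (hu : u 1 = counit) (hv : v 1 = counit)
    (b : B) : pairingTwist u v 1 b = 1 ⊗ₜ b := by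
  have h : comul₂ k A 1 = ∑ _i : Fin 1, ((1 : A) ⊗ₜ[k] (1 : A)) ⊗ₜ[k] (1 : A) := by
    simp [comul₂_one]
  simp [pairingTwist_eq_sum_left u v b h, hu, hv, leftHit_counit, rightHit_counit]

theorem pairingTwist_one_right (u v : A →ₗ[k] B →ₗ[k] k) (hu : u.flip 1 = counit)
    (hv : v.flip 1 = counit) (a : A) : pairingTwist u v a 1 = a ⊗ₜ 1 := by
  have h : comul₂ k B 1 = ∑ _i : Fin 1, ((1 : B) ⊗ₜ[k] (1 : B)) ⊗ₜ[k] (1 : B) := by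
    simp [comul₂_one]
  simp [pairingTwist_eq_sum_right u v a h, hu, hv, leftHit_counit, rightHit_counit]

end Twist

theorem functionalConv_eq_sum {k C : Type} [Field k] [AddCommGroup C] [Module k C]
    [Coalgebra k C] (f g : C →ₗ[k] k) {c : C} {p : ℕ} {c1 c2 : Fin p → C}
    (hc : comul (R := k) c = ∑ i, c1 i ⊗ₜ[k] c2 i) :
    functionalConv f g c = ∑ i, f (c1 i) * g (c2 i) := by
  simp [functionalConv, hc]

end Helpers

theorem stmt4 (k A B : Type) [Field k] [Ring A] [Ring B] [Bialgebra k A] [Bialgebra k B]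
    (u v : A →ₗ[k] B →ₗ[k] k)
    -- `u` is a dual pairing of `A^op` with `B`
    (hu1 : ∀ a : A, u a 1 = Coalgebra.counit (R := k) a)
    (hu2 : ∀ b : B, u 1 b = Coalgebra.counit (R := k) b)
    (hu3 : ∀ (a : A) (b b' : B) (p : ℕ) (a1 a2 : Fin p → A),
        Coalgebra.comul (R := k) a = ∑ i, a1 i ⊗ₜ[k] a2 i →
        ∑ i, u (a1 i) b * u (a2 i) b' = u a (b * b'))
    (hu4 : ∀ (a a' : A) (b : B) (p : ℕ) (b1 b2 : Fin p → B),
        Coalgebra.comul (R := k) b = ∑ i, b1 i ⊗ₜ[k] b2 i →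
        ∑ i, u a (b1 i) * u a' (b2 i) = u (a' * a) b)
    -- `v` is a dual pairing of `A` with `B^op`
    (hv1 : ∀ a : A, v a 1 = Coalgebra.counit (R := k) a)
    (hv2 : ∀ b : B, v 1 b = Coalgebra.counit (R := k) b)
    (hv3 : ∀ (a : A) (b b' : B) (p : ℕ) (a1 a2 : Fin p → A),
        Coalgebra.comul (R := k) a = ∑ i, a1 i ⊗ₜ[k] a2 i →
        ∑ i, v (a1 i) b * v (a2 i) b' = v a (b' * b))
    (hv4 : ∀ (a a' : A) (b : B) (p : ℕ) (b1 b2 : Fin p → B),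
        Coalgebra.comul (R := k) b = ∑ i, b1 i ⊗ₜ[k] b2 i →
        ∑ i, v a (b1 i) * v a' (b2 i) = v (a * a') b) :
    ∃ μ : (A ⊗[k] B) →ₗ[k] (A ⊗[k] B) →ₗ[k] (A ⊗[k] B),
      -- the defining formula for the twisted multiplication
      (∀ (a a' : A) (b b' : B) (p p' : ℕ) (a1 a2 a3 : Fin p → A) (b1 b2 b3 : Fin p' → B),
          comul₂ k A a' = ∑ i, (a1 i ⊗ₜ[k] a2 i) ⊗ₜ[k] a3 i →
          comul₂ k B b = ∑ j, (b1 j ⊗ₜ[k] b2 j) ⊗ₜ[k] b3 j →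
          μ (a ⊗ₜ[k] b) (a' ⊗ₜ[k] b') =
            ∑ i, ∑ j, (v (a1 i) (b1 j) * u (a3 i) (b3 j)) • ((a * a2 i) ⊗ₜ[k] (b2 j * b'))) ∧
      -- associativity
      (∀ x y z : A ⊗[k] B, μ (μ x y) z = μ x (μ y z)) ∧
      -- `1 ⊗ 1` is a unit
      (∀ x : A ⊗[k] B, μ ((1 : A) ⊗ₜ[k] (1 : B)) x = x) ∧
      (∀ x : A ⊗[k] B, μ x ((1 : A) ⊗ₜ[k] (1 : B)) = x) ∧
      -- `a ↦ a ⊗ 1` and `b ↦ 1 ⊗ b` are multiplicative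
      (∀ a a' : A, μ (a ⊗ₜ[k] (1 : B)) (a' ⊗ₜ[k] (1 : B)) = (a * a') ⊗ₜ[k] (1 : B)) ∧
      (∀ b b' : B, μ ((1 : A) ⊗ₜ[k] b) ((1 : A) ⊗ₜ[k] b') = (1 : A) ⊗ₜ[k] (b * b')) ∧
      (∀ (a : A) (b : B), μ (a ⊗ₜ[k] (1 : B)) ((1 : A) ⊗ₜ[k] b) = a ⊗ₜ[k] b) ∧
      -- the twisting map formula `τ(b ⊗ a) = Σ v(a₁,b₁) u(a₃,b₃) a₂ ⊗ b₂`
      (∀ (a : A) (b : B) (p p' : ℕ) (a1 a2 a3 : Fin p → A) (b1 b2 b3 : Fin p' → B),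
          comul₂ k A a = ∑ i, (a1 i ⊗ₜ[k] a2 i) ⊗ₜ[k] a3 i →
          comul₂ k B b = ∑ j, (b1 j ⊗ₜ[k] b2 j) ⊗ₜ[k] b3 j →
          μ ((1 : A) ⊗ₜ[k] b) (a ⊗ₜ[k] (1 : B)) =
            ∑ i, ∑ j, (v (a1 i) (b1 j) * u (a3 i) (b3 j)) • (a2 i ⊗ₜ[k] b2 j)) := by
  have hu4' (a a' : A) : u (a' * a) = functionalConv (u a) (u a') := by
    ext b
    obtain ⟨p, b1, b2, hb⟩ := TensorProduct.exists_sum_tmul_eq (Coalgebra.comul (R := k) b)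
    rw [functionalConv_eq_sum _ _ hb, hu4 a a' b p b1 b2 hb]
  have hv4' (a a' : A) : v (a * a') = functionalConv (v a) (v a') := by
    ext b
    obtain ⟨p, b1, b2, hb⟩ := TensorProduct.exists_sum_tmul_eq (Coalgebra.comul (R := k) b)
    rw [functionalConv_eq_sum _ _ hb, hv4 a a' b p b1 b2 hb]
  have hu3' (b b' : B) : u.flip (b * b') = functionalConv (u.flip b) (u.flip b') := by
    ext a
    obtain ⟨p, a1, a2, ha⟩ := TensorProduct.exists_sum_tmul_eq (Coalgebra.comul (R := k) a)
    rw [functionalConv_eq_sum _ _ ha]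
    exact (hu3 a b b' p a1 a2 ha).symm
  have hv3' (b b' : B) : v.flip (b' * b) = functionalConv (v.flip b) (v.flip b') := by
    ext a
    obtain ⟨p, a1, a2, ha⟩ := TensorProduct.exists_sum_tmul_eq (Coalgebra.comul (R := k) a)
    rw [functionalConv_eq_sum _ _ ha]
    exact (hv3 a b b' p a1 a2 ha).symm
  have one_left := pairingTwist_one_left u v (LinearMap.ext hu2) (LinearMap.ext hv2)
  have one_right := pairingTwist_one_right u v (LinearMap.ext hu1) (LinearMap.ext hv1)
  refine ⟨twistedMul (pairingTwist u v), ?_, ?_, ?_, ?_, ?_, ?_, ?_, ?_⟩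
  · intro a a' b b' p p' a1 a2 a3 b1 b2 b3 ha hb
    simp [pairingTwist_eq_sum u v ha hb]
  · exact twistedMul_assoc _ (pairingTwist_mul_left u v hu4' hv4')
      (pairingTwist_mul_right u v hu3' hv3')
  · intro x
    induction x with
    | zero => simp
    | add x y hx hy => simp only [map_add, hx, hy]
    | tmul a b => simp [one_right]
  · intro x
    induction x with
    | zero => simp
    | add x y hx hy => simp only [map_add, LinearMap.add_apply, hx, hy]
    | tmul a b => simp [one_left]
  · simp [one_right]
  · simp [one_left]
  · simp [one_right]
  · intro a b p p' a1 a2 a3 b1 b2 b3 ha hb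
    simp [pairingTwist_eq_sum u v ha hb]
end
end

section
/- In 𝒪_q(Mat_{2n}), set x_{ij} := Σ_{k=1}^{n} (t_{i,2k−1} t_{j,2k} − q t_{i,2k} t_{j,2k−1}) for 1 ≤ i,j ≤ 2n. Then: (i) x_{ii} = 0 for all i and x_{ij} = −q⁻¹ x_{ji} for all i < j; and (ii) for all l, d, h, k ∈ {1,…,2n}: Σ_{j,s,a,v} r^{ld}_{js} x_{ja} r^{hs}_{av} x_{vk} = Σ_{s,a,b,u} x_{ds} r^{as}_{lb} x_{au} r^{ub}_{hk} (the entrywise form of the reflection-type matrix equation R X₁ R^{t₁} X₂ = X₂ R^{t₁} X₁ R, where X = (x_{ij})). -/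
open scoped BigOperators TensorProduct

noncomputable section

/-- the generator `t_{ij}` of the free algebra -/
def Tg {n : ℕ} (i j : Fin n) : FreeAlgebra K (Fin n × Fin n) := FreeAlgebra.ι K (i, j)

/-- defining relations of `𝒪_q(Mat_n)` -/
inductive matRel (n : ℕ) :
    FreeAlgebra K (Fin n × Fin n) → FreeAlgebra K (Fin n × Fin n) → Prop
  | rowq (l i j : Fin n) (h : i < j) :
      matRel n (Tg l i * Tg l j) (q • (Tg l j * Tg l i))
  | colq (l i j : Fin n) (h : i < j) :
      matRel n (Tg i l * Tg j l) (q • (Tg j l * Tg i l))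
  | anti (i k j l : Fin n) (h1 : i < k) (h2 : j < l) :
      matRel n (Tg i l * Tg k j) (Tg k j * Tg i l)
  | main (i k j l : Fin n) (h1 : i < k) (h2 : j < l) :
      matRel n (Tg i j * Tg k l) (Tg k l * Tg i j + (q - q⁻¹) • (Tg k j * Tg i l))

/-- the quantized function algebra `𝒪_q(Mat_n)` -/
abbrev OqMat (n : ℕ) := RingQuot (matRel n)

/-- the generator `t_{ij}` of `𝒪_q(Mat_n)` -/
def tGen {n : ℕ} (i j : Fin n) : OqMat n :=
  RingQuot.mkAlgHom K (matRel n) (Tg i j)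

/-- the odd column index `2k-1` (1-based), i.e. `2k` (0-based) -/
def c1 (n : ℕ) (k : Fin n) : Fin (2 * n) := ⟨2 * (k : ℕ), by have := k.isLt; omega⟩

/-- the even column index `2k` (1-based), i.e. `2k+1` (0-based) -/
def c2 (n : ℕ) (k : Fin n) : Fin (2 * n) := ⟨2 * (k : ℕ) + 1, by have := k.isLt; omega⟩

/-- the Type AII quantum skew-symmetric matrix generators -/
def xAII (n : ℕ) (i j : Fin (2 * n)) : OqMat (2 * n) :=
  ∑ k : Fin n, (tGen i (c1 n k) * tGen j (c2 n k) - q • (tGen i (c2 n k) * tGen j (c1 n k)))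

/-- The involution exchanging the two members of each pair `{2k-1, 2k}`. -/
def pairSwap (n : ℕ) (i : Fin (2 * n)) : Fin (2 * n) :=
  ⟨if (i : ℕ) % 2 = 0 then i + 1 else i - 1, by have := i.isLt; split_ifs <;> omega⟩

/-- The nonzero entry in row `i` of the block-diagonal matrix `J` with `X = T J Tᵗ`. -/
def pairWeight (n : ℕ) (i : Fin (2 * n)) : K := if (i : ℕ) % 2 = 0 then 1 else -q

theorem pairSwap_pairSwap (n : ℕ) (i : Fin (2 * n)) : pairSwap n (pairSwap n i) = i := by
  ext
  simp only [pairSwap]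
  split_ifs <;> omega

theorem pairSwap_lt_or_gt (n : ℕ) (i : Fin (2 * n)) :
    (i < pairSwap n i ∧ pairWeight n i = 1 ∧ pairWeight n (pairSwap n i) = -q) ∨
      (pairSwap n i < i ∧ pairWeight n i = -q ∧ pairWeight n (pairSwap n i) = 1) := by
  simp only [pairWeight, pairSwap, Fin.lt_def]
  rcases Nat.mod_two_eq_zero_or_one i with h | h
  · have : ((i : ℕ) + 1) % 2 ≠ 0 := by omega
    simp [h, this]
  · have : ((i : ℕ) - 1) % 2 = 0 := by omega
    have : (i : ℕ) - 1 < i := by omega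
    simp [*]

theorem pair_trichotomy (n : ℕ) (i j : Fin (2 * n)) :
    i = j ∨ i = pairSwap n j ∨
      (i < j ∧ i < pairSwap n j ∧ pairSwap n i < j ∧ pairSwap n i < pairSwap n j) ∨
      (j < i ∧ j < pairSwap n i ∧ pairSwap n j < i ∧ pairSwap n j < pairSwap n i) := by
  simp only [pairSwap, Fin.lt_def, Fin.ext_iff]
  split_ifs <;> omega

theorem eq_pairSwap_iff (n : ℕ) (i j : Fin (2 * n)) : pairSwap n i = j ↔ i = pairSwap n j := by
  constructor
  · rintro rfl; rw [pairSwap_pairSwap]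
  · rintro rfl; rw [pairSwap_pairSwap]

theorem Rmat_apply (N : ℕ) (i j k l : Fin N) :
    Rmat N (i, j) (k, l) = (if i = k then if j = l then if i = j then q else 1 else 0 else 0) +
      (if i = l then if j = k then if k < i then q - q⁻¹ else 0 else 0 else 0) := by
  simp only [Rmat, Matrix.of_apply]
  by_cases hik : i = k
  · subst hik
    by_cases hjl : j = l
    · subst hjl; by_cases hij : i = j <;> simp [hij]
    · by_cases hil : i = l <;> simp [hjl, hil]
  · simp [hik, ite_and]

theorem sum_Rmat_row {M : Type*} [AddCommGroup M] [Module K M] (N : ℕ) (i j : Fin N)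
    (f : Fin N → Fin N → M) :
    ∑ a, ∑ b, Rmat N (i, j) (a, b) • f a b =
      (if i = j then q else 1) • f i j + (if j < i then q - q⁻¹ else 0) • f j i := by
  simp only [Rmat_apply, add_smul, Finset.sum_add_distrib, ite_smul, zero_smul,
    Finset.sum_ite_eq, Finset.sum_ite_irrel, Finset.sum_const_zero, Finset.mem_univ, if_true]

theorem sum_Rmat_col {M : Type*} [AddCommGroup M] [Module K M] (N : ℕ) (k l : Fin N)
    (f : Fin N → Fin N → M) :
    ∑ a, ∑ b, Rmat N (a, b) (k, l) • f a b =
      (if k = l then q else 1) • f k l + (if k < l then q - q⁻¹ else 0) • f l k := by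
  simp only [Rmat_apply, add_smul, Finset.sum_add_distrib, ite_smul, zero_smul,
    Finset.sum_ite_eq', Finset.sum_ite_irrel, Finset.sum_const_zero, Finset.mem_univ, if_true]

/-- The defining relations of quantum matrices, for a matrix over an arbitrary algebra. -/
structure IsQuantumMatrix {N : ℕ} {A : Type*} [Ring A] [Algebra K A] (t : Fin N → Fin N → A) :
    Prop where
  row : ∀ l i j, i < j → t l i * t l j = q • (t l j * t l i)
  col : ∀ l i j, i < j → t i l * t j l = q • (t j l * t i l)
  anti : ∀ i k j l, i < k → j < l → t i l * t k j = t k j * t i l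
  main : ∀ i k j l, i < k → j < l →
    t i j * t k l = t k l * t i j + (q - q⁻¹) • (t k j * t i l)

theorem isQuantumMatrix_tGen (N : ℕ) :
    IsQuantumMatrix (fun i j : Fin N => (tGen i j : OqMat N)) where
  row l i j h := by
    simpa only [map_mul, map_smul, tGen] using RingQuot.mkAlgHom_rel K (matRel.rowq l i j h)
  col l i j h := by
    simpa only [map_mul, map_smul, tGen] using RingQuot.mkAlgHom_rel K (matRel.colq l i j h)
  anti i k j l h1 h2 := by
    simpa only [map_mul, tGen] using RingQuot.mkAlgHom_rel K (matRel.anti i k j l h1 h2)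
  main i k j l h1 h2 := by
    simpa only [map_mul, map_smul, map_add, tGen] using
      RingQuot.mkAlgHom_rel K (matRel.main i k j l h1 h2)

namespace IsQuantumMatrix

variable {N : ℕ} {A : Type*} [Ring A] [Algebra K A] {t : Fin N → Fin N → A}

theorem transpose (ht : IsQuantumMatrix t) : IsQuantumMatrix fun i j => t j i where
  row l i j h := ht.col l i j h
  col l i j h := ht.row l i j h
  anti i k j l h1 h2 := (ht.anti j l i k h2 h1).symm
  main i k j l h1 h2 := by rw [ht.main j l i k h2 h1, ht.anti j l i k h2 h1]

/-- The relation `R T₁ T₂ = T₂ T₁ R`. -/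
theorem rtt (ht : IsQuantumMatrix t) (i j k l : Fin N) :
    ∑ a, ∑ b, Rmat N (i, j) (a, b) • (t a k * t b l) =
      ∑ a, ∑ b, Rmat N (a, b) (k, l) • (t j b * t i a) := by
  rw [sum_Rmat_row N i j (fun a b => t a k * t b l),
    sum_Rmat_col N k l (fun a b => t j b * t i a)]
  have hq : q * q = 1 + (q - q⁻¹) * q := by have := q_ne_zero; field_simp; ring
  rcases lt_trichotomy i j with hij | rfl | hij <;> rcases lt_trichotomy k l with hkl | rfl | hkl
  · simp [hij.ne, hkl.ne, hij.not_gt, hkl, ht.main i j k l hij hkl]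
  · simp [hij.ne, hij.not_gt, ht.col k i j hij]
  · simp [hij.ne, hkl.ne', hij.not_gt, hkl.not_gt, ht.anti i j l k hij hkl]
  · simp only [hkl.ne, hkl, lt_irrefl, if_true, if_false, ht.row i k l hkl, hq, zero_smul,
      smul_smul, add_smul, one_smul, zero_mul, add_zero]
  · simp
  · simp [hkl.ne', hkl.not_gt, ht.row i l k hkl]
  · simp [hij.ne', hkl.ne, hij, hkl, ht.anti j i k l hij hkl]
  · simp only [hij.ne', hij, lt_irrefl, if_true, if_false, ht.col k j i hij, hq, zero_smul,
      smul_smul, add_smul, one_smul, zero_mul, add_zero]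
  · simp [hij.ne', hkl.ne', hij, hkl.not_gt, ht.main j i l k hij hkl, ht.anti j i l k hij hkl]

/-- The relation `R T₁ T₂ = T₂ T₁ R` for the transpose of `T`. -/
theorem rtt_transpose (ht : IsQuantumMatrix t) (i j k l : Fin N) :
    ∑ a, ∑ b, Rmat N (a, b) (k, l) • (t b j * t a i) =
      ∑ a, ∑ b, Rmat N (i, j) (a, b) • (t k a * t l b) :=
  (ht.transpose.rtt i j k l).symm

theorem minor_swap (ht : IsQuantumMatrix t) (i j k l : Fin N) (hij : i < j) (hkl : k < l) :
    t i k * t j l - q • (t i l * t j k) = (-q⁻¹) • (t j k * t i l - q • (t j l * t i k)) := by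
  rw [ht.main i j k l hij hkl, ht.anti i j k l hij hkl, smul_sub, smul_smul, sub_smul, neg_mul,
    inv_mul_cancel₀ q_ne_zero, neg_smul, neg_smul, one_smul]
  abel

end IsQuantumMatrix

set_option linter.unusedSimpArgs false in
/-- The matrix `J` itself satisfies the reflection equation. -/
theorem pairing_reflection (n : ℕ) (l d h k : Fin (2 * n)) :
    ∑ j, ∑ s, Rmat (2 * n) (l, d) (j, s) * Rmat (2 * n) (h, s) (pairSwap n j, pairSwap n k) *
        (pairWeight n j * pairWeight n (pairSwap n k)) =
      ∑ a, ∑ b, Rmat (2 * n) (a, pairSwap n d) (l, b) * Rmat (2 * n) (pairSwap n a, b) (h, k) *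
        (pairWeight n d * pairWeight n a) := by
  have hq := q_ne_zero
  have H := sum_Rmat_row (2 * n) l d (fun j s => Rmat (2 * n) (h, s) (pairSwap n j, pairSwap n k) *
        (pairWeight n j * pairWeight n (pairSwap n k)))
  simp only [smul_eq_mul, ← mul_assoc] at H
  simp only [← mul_assoc]
  rw [H]
  simp only [Rmat_apply]
  simp only [add_mul, mul_add, ite_mul, mul_ite, zero_mul, mul_zero, Finset.sum_add_distrib,
    Finset.sum_ite_eq', Finset.sum_ite_irrel, Finset.sum_const_zero, Finset.mem_univ, if_true,
    eq_pairSwap_iff]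
  simp only [pairSwap_pairSwap]
  clear H
  by_cases hA : h = pairSwap n l ∧ d = pairSwap n k
  · obtain ⟨rfl, rfl⟩ := hA
    simp only [pairSwap_pairSwap]
    rcases pair_trichotomy n l k with rfl | rfl | ⟨h1, h2, h3, h4⟩ | ⟨h1, h2, h3, h4⟩
    · rcases pairSwap_lt_or_gt n l with ⟨h1, h2, h3⟩ | ⟨h1, h2, h3⟩ <;>
      simp [h1, h1.ne, h1.ne', h1.not_gt, h2, h3]
    · rcases pairSwap_lt_or_gt n k with ⟨h1, h2, h3⟩ | ⟨h1, h2, h3⟩ <;>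
      simp [pairSwap_pairSwap, h1, h1.ne, h1.ne', h1.not_gt, h2, h3]
    all_goals
      rcases pairSwap_lt_or_gt n l with ⟨h5, h6, h7⟩ | ⟨h5, h6, h7⟩ <;>
      rcases pairSwap_lt_or_gt n k with ⟨h8, h9, h10⟩ | ⟨h8, h9, h10⟩ <;>
      simp [h1, h1.ne, h1.ne', h1.not_gt, h2, h2.ne, h2.ne', h2.not_gt, h3, h3.ne, h3.ne',
        h3.not_gt, h4, h4.ne, h4.ne', h4.not_gt, h5, h5.ne, h5.ne', h5.not_gt, h6, h7, h8,
        h8.ne, h8.ne', h8.not_gt, h9, h10]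
  by_cases hB : h = pairSwap n k ∧ d = pairSwap n l
  · obtain ⟨rfl, rfl⟩ := hB
    simp only [pairSwap_pairSwap]
    rcases pair_trichotomy n l k with rfl | rfl | ⟨h1, h2, h3, h4⟩ | ⟨h1, h2, h3, h4⟩
    · rcases pairSwap_lt_or_gt n l with ⟨h1, h2, h3⟩ | ⟨h1, h2, h3⟩ <;>
      simp [h1, h1.ne, h1.ne', h1.not_gt, h2, h3]
    · rcases pairSwap_lt_or_gt n k with ⟨h1, h2, h3⟩ | ⟨h1, h2, h3⟩ <;>
      simp [pairSwap_pairSwap, h1, h1.ne, h1.ne', h1.not_gt, h2, h3]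
      field_simp
      ring
    all_goals
      rcases pairSwap_lt_or_gt n l with ⟨h5, h6, h7⟩ | ⟨h5, h6, h7⟩ <;>
      rcases pairSwap_lt_or_gt n k with ⟨h8, h9, h10⟩ | ⟨h8, h9, h10⟩ <;>
      simp [h1, h1.ne, h1.ne', h1.not_gt, h2, h2.ne, h2.ne', h2.not_gt, h3, h3.ne, h3.ne',
        h3.not_gt, h4, h4.ne, h4.ne', h4.not_gt, h5, h5.ne, h5.ne', h5.not_gt, h6, h7, h8,
        h8.ne, h8.ne', h8.not_gt, h9, h10] <;> field_simp <;> ring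
  by_cases hC : h = pairSwap n d ∧ l = pairSwap n k
  · obtain ⟨rfl, rfl⟩ := hC
    simp only [pairSwap_pairSwap]
    rcases pair_trichotomy n d k with rfl | rfl | ⟨h1, h2, h3, h4⟩ | ⟨h1, h2, h3, h4⟩
    · rcases pairSwap_lt_or_gt n d with ⟨h1, h2, h3⟩ | ⟨h1, h2, h3⟩ <;>
      simp [h1, h1.ne, h1.ne', h1.not_gt, h2, h3]
      field_simp
      ring
    · rcases pairSwap_lt_or_gt n k with ⟨h1, h2, h3⟩ | ⟨h1, h2, h3⟩ <;>
      simp [pairSwap_pairSwap, h1, h1.ne, h1.ne', h1.not_gt, h2, h3]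
    all_goals
      rcases pairSwap_lt_or_gt n d with ⟨h5, h6, h7⟩ | ⟨h5, h6, h7⟩ <;>
      rcases pairSwap_lt_or_gt n k with ⟨h8, h9, h10⟩ | ⟨h8, h9, h10⟩ <;>
      simp [h1, h1.ne, h1.ne', h1.not_gt, h2, h2.ne, h2.ne', h2.not_gt, h3, h3.ne, h3.ne',
        h3.not_gt, h4, h4.ne, h4.ne', h4.not_gt, h5, h5.ne, h5.ne', h5.not_gt, h6, h7, h8,
        h8.ne, h8.ne', h8.not_gt, h9, h10]
  have h1 : ¬ (k = pairSwap n l ∧ d = pairSwap n h) := by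
    rintro ⟨rfl, rfl⟩; simp [pairSwap_pairSwap] at hC
  have h2 : ¬ (h = pairSwap n k ∧ l = pairSwap n d) := by
    rintro ⟨rfl, rfl⟩; simp [pairSwap_pairSwap] at hB
  have h3 : ¬ (k = pairSwap n h ∧ d = pairSwap n l) := by
    rintro ⟨rfl, rfl⟩; simp [pairSwap_pairSwap] at hB
  simp only [← ite_and, ← and_assoc, hA, hB, hC, h1, h2, h3, false_and, if_false]
  simp

section SumPermutations

variable {ι M : Type*} [Fintype ι] [AddCommMonoid M]

theorem sum_pull_third (f : ι → ι → ι → M) :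
    ∑ a, ∑ b, ∑ c, f a b c = ∑ c, ∑ a, ∑ b, f a b c :=
  (Finset.sum_congr rfl fun _ _ => Finset.sum_comm).trans Finset.sum_comm

theorem sum_pull_fourth (f : ι → ι → ι → ι → M) :
    ∑ a, ∑ b, ∑ c, ∑ d, f a b c d = ∑ d, ∑ a, ∑ b, ∑ c, f a b c d :=
  (Finset.sum_congr rfl fun _ _ => sum_pull_third _).trans Finset.sum_comm

theorem sum_pull_fifth (f : ι → ι → ι → ι → ι → M) :
    ∑ a, ∑ b, ∑ c, ∑ d, ∑ e, f a b c d e = ∑ e, ∑ a, ∑ b, ∑ c, ∑ d, f a b c d e :=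
  (Finset.sum_congr rfl fun _ _ => sum_pull_fourth _).trans Finset.sum_comm

theorem sum_pull_sixth (f : ι → ι → ι → ι → ι → ι → M) :
    ∑ a, ∑ b, ∑ c, ∑ d, ∑ e, ∑ g, f a b c d e g =
      ∑ g, ∑ a, ∑ b, ∑ c, ∑ d, ∑ e, f a b c d e g :=
  (Finset.sum_congr rfl fun _ _ => sum_pull_fifth _).trans Finset.sum_comm

end SumPermutations

theorem sub_smul_eq {A : Type*} [Ring A] [Algebra K A] (u v : A) :
    u - q • v = (1 : K) • u + (-q) • v := by
  rw [one_smul, neg_smul, sub_eq_add_neg]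

section Reflection

variable {n : ℕ} {A : Type*} [Ring A] [Algebra K A] {t x : Fin (2 * n) → Fin (2 * n) → A}

theorem mul_expand
    (hx : ∀ i j, x i j = ∑ α, pairWeight n α • (t i α * t j (pairSwap n α)))
    (i j k l : Fin (2 * n)) :
    x i j * x k l = ∑ α, ∑ γ, (pairWeight n α * pairWeight n γ) •
      (t i α * (t j (pairSwap n α) * (t k γ * t l (pairSwap n γ)))) := by
  simp only [hx, Finset.mul_sum, Finset.sum_mul, Finset.smul_sum, mul_smul_comm, smul_mul_assoc,
    smul_smul, mul_assoc]
  rw [Finset.sum_comm]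
  simp only [mul_comm]

theorem reflection_lhs (ht : IsQuantumMatrix t)
    (hx : ∀ i j, x i j = ∑ α, pairWeight n α • (t i α * t j (pairSwap n α)))
    (l d h k : Fin (2 * n)) :
    ∑ j, ∑ s, ∑ a, ∑ v,
        (Rmat (2 * n) (l, d) (j, s) * Rmat (2 * n) (h, s) (a, v)) • (x j a * x v k) =
      ∑ s, ∑ j, ∑ a, ∑ γ,
        (∑ α, ∑ v, Rmat (2 * n) (j, s) (α, v) * Rmat (2 * n) (a, v) (pairSwap n α, γ) *
          (pairWeight n α * pairWeight n γ)) •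
        (t d s * (t l j * (t h a * t k (pairSwap n γ)))) := by
  calc
    _ = ∑ α, ∑ γ, ∑ j, ∑ s, (pairWeight n α * pairWeight n γ * Rmat (2 * n) (l, d) (j, s)) •
        (t j α * ((∑ a, ∑ v, Rmat (2 * n) (h, s) (a, v) • (t a (pairSwap n α) * t v γ)) *
          t k (pairSwap n γ))) := by
      simp only [mul_expand hx, Finset.mul_sum, Finset.sum_mul, Finset.smul_sum, mul_smul_comm,
        smul_mul_assoc, smul_smul, mul_assoc]
      refine (sum_pull_sixth _).trans ((sum_pull_sixth _).trans ?_)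
      simp only [mul_comm, mul_left_comm, mul_assoc]
    _ = ∑ α, ∑ γ, ∑ a, ∑ v,
        (pairWeight n α * pairWeight n γ * Rmat (2 * n) (a, v) (pairSwap n α, γ)) •
        ((∑ j, ∑ s, Rmat (2 * n) (l, d) (j, s) • (t j α * t s v)) *
          (t h a * t k (pairSwap n γ))) := by
      conv_lhs => simp only [ht.rtt]
      simp only [Finset.mul_sum, Finset.sum_mul, Finset.smul_sum, mul_smul_comm,
        smul_mul_assoc, smul_smul, mul_assoc]
      refine Finset.sum_congr rfl fun α _ => Finset.sum_congr rfl fun γ _ => ?_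
      refine (sum_pull_fourth _).trans ((sum_pull_fourth _).trans ?_)
      simp only [mul_comm]
    _ = _ := by
      simp only [ht.rtt]
      simp only [Finset.sum_mul, Finset.smul_sum, Finset.sum_smul,
        smul_mul_assoc, smul_smul, mul_assoc]
      refine (sum_pull_fourth _).trans <| (Finset.sum_comm).trans <| (sum_pull_third _).trans <|
        (sum_pull_fourth _).trans <| (sum_pull_fifth _).trans <| (sum_pull_sixth _).trans ?_
      simp only [mul_comm, mul_left_comm, mul_assoc]

theorem reflection_rhs (ht : IsQuantumMatrix t)
    (hx : ∀ i j, x i j = ∑ α, pairWeight n α • (t i α * t j (pairSwap n α)))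
    (l d h k : Fin (2 * n)) :
    ∑ s, ∑ a, ∑ b, ∑ u,
        (Rmat (2 * n) (a, s) (l, b) * Rmat (2 * n) (u, b) (h, k)) • (x d s * x a u) =
      ∑ α, ∑ a, ∑ u, ∑ b,
        (∑ γ, ∑ s, Rmat (2 * n) (γ, pairSwap n α) (a, s) * Rmat (2 * n) (pairSwap n γ, s) (u, b) *
          (pairWeight n α * pairWeight n γ)) •
        (t d α * (t l a * (t h u * t k b))) := by
  calc
    _ = ∑ α, ∑ γ, ∑ b, ∑ u, (pairWeight n α * pairWeight n γ * Rmat (2 * n) (u, b) (h, k)) •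
        (t d α * ((∑ a, ∑ s, Rmat (2 * n) (a, s) (l, b) • (t s (pairSwap n α) * t a γ)) *
          t u (pairSwap n γ))) := by
      simp only [mul_expand hx, Finset.mul_sum, Finset.sum_mul, Finset.smul_sum, mul_smul_comm,
        smul_mul_assoc, smul_smul, mul_assoc]
      refine (Finset.sum_comm).trans <| (sum_pull_fourth _).trans <| (sum_pull_fourth _).trans <|
        (sum_pull_sixth _).trans <| (sum_pull_sixth _).trans ?_
      simp only [mul_comm, mul_assoc]
    _ = ∑ α, ∑ γ, ∑ a, ∑ s,
        (pairWeight n α * pairWeight n γ * Rmat (2 * n) (γ, pairSwap n α) (a, s)) •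
        (t d α * (t l a *
          ∑ u, ∑ b, Rmat (2 * n) (u, b) (h, k) • (t b s * t u (pairSwap n γ)))) := by
      conv_lhs => simp only [ht.rtt_transpose]
      simp only [Finset.mul_sum, Finset.sum_mul, Finset.smul_sum, mul_smul_comm,
        smul_mul_assoc, smul_smul, mul_assoc]
      refine Finset.sum_congr rfl fun α _ => Finset.sum_congr rfl fun γ _ => ?_
      refine (Finset.sum_comm).trans <| (sum_pull_fourth _).trans <| (sum_pull_fourth _).trans ?_
      simp only [mul_comm]
    _ = _ := by
      simp only [ht.rtt_transpose]
      simp only [Finset.mul_sum, Finset.smul_sum, Finset.sum_smul, mul_smul_comm,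
        smul_smul, mul_assoc]
      refine Finset.sum_congr rfl fun α _ => ?_
      refine (sum_pull_third _).trans <| (Finset.sum_comm).trans <| (sum_pull_fifth _).trans <|
        (sum_pull_fifth _).trans <| (sum_pull_fifth _).trans ?_
      simp only [mul_comm, mul_left_comm, mul_assoc]

/-- If `X = T J Tᵗ` for a quantum matrix `T`, then `X` satisfies the reflection equation. -/
theorem reflection (ht : IsQuantumMatrix t)
    (hx : ∀ i j, x i j = ∑ α, pairWeight n α • (t i α * t j (pairSwap n α)))
    (l d h k : Fin (2 * n)) :
    ∑ j, ∑ s, ∑ a, ∑ v,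
        (Rmat (2 * n) (l, d) (j, s) * Rmat (2 * n) (h, s) (a, v)) • (x j a * x v k) =
      ∑ s, ∑ a, ∑ b, ∑ u,
        (Rmat (2 * n) (a, s) (l, b) * Rmat (2 * n) (u, b) (h, k)) • (x d s * x a u) := by
  rw [reflection_lhs ht hx, reflection_rhs ht hx]
  refine Finset.sum_congr rfl fun s _ => Finset.sum_congr rfl fun j _ =>
    Finset.sum_congr rfl fun a _ => ?_
  refine Fintype.sum_bijective (pairSwap n)
    (Function.Involutive.bijective (pairSwap_pairSwap n)) _ _ fun γ => ?_
  have := pairing_reflection n j s a (pairSwap n γ)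
  rw [pairSwap_pairSwap] at this
  rw [this]

end Reflection

theorem xAII_eq_sum (n : ℕ) (i j : Fin (2 * n)) :
    xAII n i j = ∑ α, pairWeight n α • (tGen i α * tGen j (pairSwap n α) : OqMat (2 * n)) := by
  rw [← (finProdFinEquiv.trans (finCongr (mul_comm n 2))).sum_comp, Fintype.sum_prod_type]
  refine Finset.sum_congr rfl fun k _ => ?_
  rw [Fin.sum_univ_two]
  have e1 : (finProdFinEquiv.trans (finCongr (mul_comm n 2))) (k, 0) = c1 n k := by
    ext; simp [c1]
  have e2 : (finProdFinEquiv.trans (finCongr (mul_comm n 2))) (k, 1) = c2 n k := by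
    ext; simp [c2, add_comm]
  have s1 : pairSwap n (c1 n k) = c2 n k := by ext; simp [pairSwap, c1, c2]
  have s2 : pairSwap n (c2 n k) = c1 n k := by rw [← s1, pairSwap_pairSwap]
  have w1 : pairWeight n (c1 n k) = 1 := by simp [pairWeight, c1]
  have w2 : pairWeight n (c2 n k) = -q := by simp [pairWeight, c2]
  rw [e1, e2, s1, s2, w1, w2]
  exact sub_smul_eq _ _

theorem xAII_self (n : ℕ) (i : Fin (2 * n)) : xAII n i i = 0 := by
  refine Finset.sum_eq_zero fun k _ => ?_
  have hk : c1 n k < c2 n k := by simp [c1, c2, Fin.lt_def]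
  rw [sub_eq_zero]
  exact (isQuantumMatrix_tGen _).row i _ _ hk

theorem xAII_swap (n : ℕ) (i j : Fin (2 * n)) (hij : i < j) :
    xAII n i j = (-q⁻¹) • xAII n j i := by
  rw [xAII, xAII, Finset.smul_sum]
  refine Finset.sum_congr rfl fun k _ => ?_
  have hk : c1 n k < c2 n k := by simp [c1, c2, Fin.lt_def]
  exact (isQuantumMatrix_tGen _).minor_swap i j _ _ hij hk

theorem stmt6 (n : ℕ) :
    (∀ i : Fin (2 * n), xAII n i i = 0) ∧
    (∀ i j : Fin (2 * n), i < j → xAII n i j = (-q⁻¹) • xAII n j i) ∧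
    (∀ l d h k : Fin (2 * n),
      (∑ j : Fin (2 * n), ∑ s : Fin (2 * n), ∑ a : Fin (2 * n), ∑ v : Fin (2 * n),
        (Rmat (2 * n) (l, d) (j, s) * Rmat (2 * n) (h, s) (a, v)) • (xAII n j a * xAII n v k)) =
      (∑ s : Fin (2 * n), ∑ a : Fin (2 * n), ∑ b : Fin (2 * n), ∑ u : Fin (2 * n),
        (Rmat (2 * n) (a, s) (l, b) * Rmat (2 * n) (u, b) (h, k)) • (xAII n d s * xAII n a u))) := by
  exact ⟨xAII_self n, xAII_swap n, reflection (isQuantumMatrix_tGen _) (xAII_eq_sum n)⟩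
end
end

section
/- The assignment t_{ij} ↦ Σ_{k=1}^{n} t_{ik} ⊗ t_{jk} extends to a well-defined injective k-algebra homomorphism ψ : 𝒪_q(Mat_n) → 𝒪_q(Mat_n) ⊗_k 𝒪_q(Mat_n); in particular the elements Σ_{k=1}^{n} t_{ik} ⊗ t_{jk} satisfy the defining relations of 𝒪_q(Mat_n), and ψ is an algebra isomorphism of 𝒪_q(Mat_n) onto the subalgebra they generate. -/
open scoped BigOperators TensorProduct

noncomputable section

theorem tGen_mul_row {n : ℕ} (l : Fin n) {i j : Fin n} (h : i < j) :
    (tGen l i * tGen l j : OqMat n) = q • (tGen l j * tGen l i) := by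
  simpa only [tGen, map_mul, map_smul] using RingQuot.mkAlgHom_rel K (matRel.rowq l i j h)

theorem tGen_mul_col {n : ℕ} (l : Fin n) {i j : Fin n} (h : i < j) :
    (tGen i l * tGen j l : OqMat n) = q • (tGen j l * tGen i l) := by
  simpa only [tGen, map_mul, map_smul] using RingQuot.mkAlgHom_rel K (matRel.colq l i j h)

theorem tGen_mul_anti {n : ℕ} {i k j l : Fin n} (h1 : i < k) (h2 : j < l) :
    (tGen i l * tGen k j : OqMat n) = tGen k j * tGen i l := by
  simpa only [tGen, map_mul] using RingQuot.mkAlgHom_rel K (matRel.anti i k j l h1 h2)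

theorem tGen_mul_main {n : ℕ} {i k j l : Fin n} (h1 : i < k) (h2 : j < l) :
    (tGen i j * tGen k l : OqMat n) =
      tGen k l * tGen i j + (q - q⁻¹) • (tGen k j * tGen i l) := by
  simpa only [tGen, map_mul, map_smul, map_add] using
    RingQuot.mkAlgHom_rel K (matRel.main i k j l h1 h2)

/-- The algebra homomorphism out of `𝒪_q(Mat_n)` determined by a matrix of elements satisfying
the defining relations. -/
def OqMat.lift {n : ℕ} {A : Type} [Ring A] [Algebra K A] (x : Fin n → Fin n → A)
    (hrow : ∀ l i j, i < j → x l i * x l j = q • (x l j * x l i))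
    (hcol : ∀ l i j, i < j → x i l * x j l = q • (x j l * x i l))
    (hanti : ∀ i k j l, i < k → j < l → x i l * x k j = x k j * x i l)
    (hmain : ∀ i k j l, i < k → j < l →
      x i j * x k l = x k l * x i j + (q - q⁻¹) • (x k j * x i l)) :
    OqMat n →ₐ[K] A :=
  RingQuot.liftAlgHom K ⟨FreeAlgebra.lift K fun p => x p.1 p.2, by
    intro a b h
    cases h with
    | rowq l i j h => simpa [Tg] using hrow l i j h
    | colq l i j h => simpa [Tg] using hcol l i j h
    | anti i k j l h1 h2 => simpa [Tg] using hanti i k j l h1 h2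
    | main i k j l h1 h2 => simpa [Tg] using hmain i k j l h1 h2⟩

theorem OqMat.lift_tGen {n : ℕ} {A : Type} [Ring A] [Algebra K A] (x : Fin n → Fin n → A)
    (hrow hcol hanti hmain) (i j : Fin n) :
    OqMat.lift x hrow hcol hanti hmain (tGen i j) = x i j := by
  simp [OqMat.lift, tGen, Tg]

theorem OqMat.algHom_ext {n : ℕ} {A : Type} [Ring A] [Algebra K A] {f g : OqMat n →ₐ[K] A}
    (h : ∀ i j, f (tGen i j) = g (tGen i j)) : f = g := by
  refine RingQuot.ringQuot_ext' K f g (FreeAlgebra.hom_ext ?_)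
  funext p
  exact h p.1 p.2

/-- The transposition automorphism `t_{ij} ↦ t_{ji}`. -/
def OqMat.transpose (n : ℕ) : OqMat n →ₐ[K] OqMat n :=
  OqMat.lift (fun i j => tGen j i)
    (fun l _ _ h => tGen_mul_col l h)
    (fun l _ _ h => tGen_mul_row l h)
    (fun _ _ _ _ h1 h2 => (tGen_mul_anti h2 h1).symm)
    (fun _ _ _ _ h1 h2 => by rw [tGen_mul_main h2 h1, tGen_mul_anti h2 h1])

/-- The counit `t_{ij} ↦ δ_{ij}`. -/
def OqMat.counit (n : ℕ) : OqMat n →ₐ[K] K :=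
  OqMat.lift (fun i j => if i = j then 1 else 0)
    (fun l i j h => by have := h.ne; aesop)
    (fun l i j h => by have := h.ne; aesop)
    (fun i k j l h1 h2 => mul_comm _ _)
    (fun i k j l h1 h2 => by
      have h : ¬(k = j ∧ i = l) := by
        rintro ⟨rfl, rfl⟩
        exact lt_asymm h1 h2
      rw [mul_comm, left_eq_add]
      by_cases hk : k = j <;> by_cases hi : i = l <;> simp_all)

theorem sum_sum_congr_of_symm {n : ℕ} {M : Type} [AddCommGroup M] [Module K M]
    {f g : Fin n → Fin n → M} (hdiag : ∀ p, f p p = g p p)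
    (hlt : ∀ p r, p < r → f p r + f r p = g p r + g r p) :
    ∑ p, ∑ r, f p r = ∑ p, ∑ r, g p r := by
  have key : ∀ h : Fin n → Fin n → M,
      (2 : K) • ∑ p, ∑ r, h p r = ∑ p, ∑ r, (h p r + h r p) := by
    intro h
    simp only [Finset.sum_add_distrib]
    rw [Finset.sum_comm (f := fun p r => h r p), two_smul]
  refine smul_right_injective M (two_ne_zero (α := K)) ?_
  simp only [key]
  refine Finset.sum_congr rfl fun p _ => Finset.sum_congr rfl fun r _ => ?_
  rcases lt_trichotomy p r with h | rfl | h
  · exact hlt p r h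
  · rw [hdiag]
  · rw [add_comm (f p r), add_comm (g p r), hlt r p h]

/-- The image `∑ k, t_{ik} ⊗ t_{jk}` of `t_{ij}`. -/
def psiGen {n : ℕ} (i j : Fin n) : OqMat n ⊗[K] OqMat n :=
  ∑ k : Fin n, tGen i k ⊗ₜ[K] tGen j k

theorem psiGen_mul_psiGen {n : ℕ} (i j k l : Fin n) :
    (psiGen i j * psiGen k l : OqMat n ⊗[K] OqMat n) =
      ∑ p, ∑ r, (tGen i p * tGen k r) ⊗ₜ[K] (tGen j p * tGen l r) := by
  simp only [psiGen, Finset.sum_mul_sum, Algebra.TensorProduct.tmul_mul_tmul]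

theorem smul_sub_inv_smul_add {F M : Type*} [Field F] [AddCommGroup M] [Module F M] {c : F}
    (hc : c ≠ 0) (x y : M) : c • (x + (c - c⁻¹) • y) + y = c • c • y + c • x := by
  match_scalars <;> field_simp
  ring

theorem smul_smul_eq_add_sub_inv_smul {F M : Type*} [Field F] [AddCommGroup M] [Module F M]
    {c : F} (hc : c ≠ 0) (x : M) : c • c • x = x + (c - c⁻¹) • c • x := by
  match_scalars
  field_simp
  ring

theorem add_smul_add_smul_comm {F M : Type*} [Field F] [AddCommGroup M] [Module F M]
    (c : F) (x y z w : M) :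
    x + c • y + c • (z + c • w) + w = w + c • (y + c • w) + (x + c • z) := by
  module

theorem psiGen_mul_row {n : ℕ} (l i j : Fin n) (h : i < j) :
    (psiGen l i * psiGen l j : OqMat n ⊗[K] OqMat n) = q • (psiGen l j * psiGen l i) := by
  simp only [psiGen_mul_psiGen, Finset.smul_sum]
  refine sum_sum_congr_of_symm (M := OqMat n ⊗[K] OqMat n) (fun p => ?_) (fun p r hpr => ?_)
  · rw [tGen_mul_col p h, TensorProduct.tmul_smul]
  · rw [tGen_mul_row l hpr, tGen_mul_main h hpr, tGen_mul_anti h hpr]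
    simp only [TensorProduct.tmul_add, TensorProduct.tmul_smul, ← TensorProduct.smul_tmul']
    rw [smul_comm (q - q⁻¹) q, ← smul_add]
    exact smul_sub_inv_smul_add (M := OqMat n ⊗[K] OqMat n) q_ne_zero _ _

theorem psiGen_mul_col {n : ℕ} (l i j : Fin n) (h : i < j) :
    (psiGen i l * psiGen j l : OqMat n ⊗[K] OqMat n) = q • (psiGen j l * psiGen i l) := by
  simp only [psiGen_mul_psiGen, Finset.smul_sum]
  refine sum_sum_congr_of_symm (M := OqMat n ⊗[K] OqMat n) (fun p => ?_) (fun p r hpr => ?_)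
  · rw [tGen_mul_col p h, TensorProduct.smul_tmul']
  · rw [tGen_mul_row l hpr, tGen_mul_main h hpr, tGen_mul_anti h hpr]
    simp only [TensorProduct.add_tmul, TensorProduct.tmul_smul, ← TensorProduct.smul_tmul']
    exact smul_sub_inv_smul_add (M := OqMat n ⊗[K] OqMat n) q_ne_zero _ _

theorem psiGen_mul_anti {n : ℕ} (i k j l : Fin n) (h1 : i < k) (h2 : j < l) :
    (psiGen i l * psiGen k j : OqMat n ⊗[K] OqMat n) = psiGen k j * psiGen i l := by
  simp only [psiGen_mul_psiGen]
  refine sum_sum_congr_of_symm (M := OqMat n ⊗[K] OqMat n) (fun p => ?_) (fun p r hpr => ?_)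
  · rw [tGen_mul_col p h1, tGen_mul_col p h2, TensorProduct.tmul_smul, TensorProduct.smul_tmul']
  · rw [tGen_mul_main h1 hpr, tGen_mul_anti h1 hpr, tGen_mul_main h2 hpr, tGen_mul_anti h2 hpr]
    simp only [TensorProduct.add_tmul, TensorProduct.tmul_add, TensorProduct.tmul_smul,
      ← TensorProduct.smul_tmul']
    abel

theorem psiGen_mul_main {n : ℕ} (i k j l : Fin n) (h1 : i < k) (h2 : j < l) :
    (psiGen i j * psiGen k l : OqMat n ⊗[K] OqMat n) =
      psiGen k l * psiGen i j + (q - q⁻¹) • (psiGen k j * psiGen i l) := by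
  simp only [psiGen_mul_psiGen, Finset.smul_sum, ← Finset.sum_add_distrib]
  refine sum_sum_congr_of_symm (M := OqMat n ⊗[K] OqMat n) (fun p => ?_) (fun p r hpr => ?_)
  · rw [tGen_mul_col p h1, tGen_mul_col p h2]
    simp only [TensorProduct.tmul_smul, ← TensorProduct.smul_tmul']
    exact smul_smul_eq_add_sub_inv_smul (M := OqMat n ⊗[K] OqMat n) q_ne_zero _
  · rw [tGen_mul_main h1 hpr, tGen_mul_anti h1 hpr, tGen_mul_main h2 hpr, tGen_mul_anti h2 hpr]
    simp only [TensorProduct.add_tmul, TensorProduct.tmul_add, TensorProduct.tmul_smul,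
      ← TensorProduct.smul_tmul']
    exact add_smul_add_smul_comm (M := OqMat n ⊗[K] OqMat n) (q - q⁻¹) _ _ _ _

theorem stmt7 (n : ℕ) :
    ∃ ψ : OqMat n →ₐ[K] (OqMat n ⊗[K] OqMat n),
      (∀ i j : Fin n, ψ (tGen i j) = ∑ k : Fin n, tGen i k ⊗ₜ[K] tGen j k) ∧
      Function.Injective ψ := by
  let ψ : OqMat n →ₐ[K] (OqMat n ⊗[K] OqMat n) :=
    OqMat.lift psiGen psiGen_mul_row psiGen_mul_col psiGen_mul_anti psiGen_mul_main
  have hψ : ∀ i j : Fin n, ψ (tGen i j) = ∑ k : Fin n, tGen i k ⊗ₜ[K] tGen j k :=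
    fun i j => OqMat.lift_tGen _ _ _ _ _ i j
  let φ : (OqMat n ⊗[K] OqMat n) →ₐ[K] OqMat n :=
    ((Algebra.TensorProduct.lid K (OqMat n)).toAlgHom).comp
      (Algebra.TensorProduct.map (OqMat.counit n) (OqMat.transpose n))
  have hφψ : φ.comp ψ = AlgHom.id K (OqMat n) := by
    refine OqMat.algHom_ext fun i j => ?_
    simp [φ, hψ, OqMat.counit, OqMat.transpose, OqMat.lift_tGen]
  exact ⟨ψ, hψ, Function.LeftInverse.injective (g := φ) fun x => DFunLike.congr_fun hφψ x⟩
end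
end

section
/- In 𝒪_q(Mat_n) with x_{ij} := Σ_{k=1}^{n} t_{ik} t_{jk}, the following relations hold: x_{lh}x_{dk} = q^{−2}x_{dk}x_{lh} if d=l=k<h; x_{lh}x_{dk} = q^{−1}x_{dk}x_{lh} if d=l<k<h; x_{lh}x_{dk} = q^{−2}x_{dk}x_{lh} if d<l=k=h; x_{lh}x_{dk} = q^{−1}x_{dk}x_{lh} if d<l<k=h; x_{lh}x_{dk} = q^{−1}x_{dk}x_{lh} − (q−q⁻¹)x_{dh}x_{lk} if d<l=k<h; x_{lh}x_{dk} = x_{dk}x_{lh} − (q−q⁻¹)x_{dh}x_{lk} if d<l<k<h; x_{lh}x_{dk} = x_{dk}x_{lh} − q⁻¹(q²−q⁻²)x_{dh}x_{kl} if d=k<l=h; x_{lh}x_{dk} = x_{dk}x_{lh} − (q²−q⁻²)x_{dh}x_{kl} if d=k<l<h; x_{lh}x_{dk} = x_{dk}x_{lh} − q⁻¹(q²−q⁻²)x_{dh}x_{kl} if d<k<l=h; x_{lh}x_{dk} = x_{dk}x_{lh} − (q−q⁻¹)(q⁻¹x_{dh}x_{kl} + x_{dl}x_{kh}) if d<k<l<h;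 x_{lh}x_{dk} = x_{dk}x_{lh} if d<l<h<k; and x_{lh}x_{dk} = x_{dk}x_{lh} if d<l=h<k. -/
open scoped BigOperators TensorProduct

noncomputable section

/-- the Type AI quantum symmetric matrix generators `x_{ij} = Σ_k t_{ik} t_{jk}` -/
def xAI {n : ℕ} (i j : Fin n) : OqMat n := ∑ k : Fin n, tGen i k * tGen j k

/-- A double sum vanishes if its symmetrization does. -/
theorem sum_sum_eq_zero_of_symm (F : Type*) {J M : Type*} [Field F] [CharZero F] [LinearOrder J]
    [Fintype J] [AddCommGroup M] [Module F M] (f : J → J → M) (hdiag : ∀ a, f a a = 0)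
    (hoff : ∀ a b, a < b → f a b + f b a = 0) : ∑ a, ∑ b, f a b = 0 := by
  have hsymm : ∀ a b, f a b + f b a = 0 := by
    intro a b
    rcases lt_trichotomy a b with h | rfl | h
    · exact hoff a b h
    · simp [hdiag]
    · rw [add_comm]; exact hoff b a h
  have h2 : ∑ a, ∑ b, f a b + ∑ a, ∑ b, f a b = 0 := by
    nth_rewrite 2 [Finset.sum_comm]
    simp [← Finset.sum_add_distrib, hsymm]
  rw [← two_smul F] at h2
  exact (smul_eq_zero.mp h2).resolve_left two_ne_zero

/-- The generator `x_{ij} = Σ_k t_{ik} t_{jk}` built from a family `t`. -/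
def symGen {A I J : Type*} [Ring A] [Fintype J] (t : I → J → A) (i j : I) : A :=
  ∑ k, t i k * t j k

/-- The quantum matrix relations on a family `t` indexed by linearly ordered rows and columns,
written as rewriting rules that move smaller rows, then smaller columns, to the left. -/
structure IsQuantumMatrix_s8 {F A I J : Type*} [Field F] [Ring A] [Algebra F A]
    [LinearOrder I] [LinearOrder J] (p : F) (t : I → J → A) : Prop where
  row (i : I) {a b : J} (h : a < b) : t i b * t i a = p⁻¹ • (t i a * t i b)
  col (a : J) {i k : I} (h : i < k) : t k a * t i a = p⁻¹ • (t i a * t k a)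
  anti {i k : I} {a b : J} (h : i < k) (h' : a < b) : t k a * t i b = t i b * t k a
  main {i k : I} {a b : J} (h : i < k) (h' : a < b) :
    t k b * t i a = t i a * t k b - (p - p⁻¹) • (t i b * t k a)

namespace IsQuantumMatrix_s8

variable {F A I J : Type*} [Field F] [Ring A] [Algebra F A] [LinearOrder I] [LinearOrder J]
  {p : F} {t : I → J → A}

theorem row_assoc (H : IsQuantumMatrix_s8 p t) (i : I) {a b : J} (h : a < b) (z : A) :
    t i b * (t i a * z) = p⁻¹ • (t i a * (t i b * z)) := by
  rw [← mul_assoc, H.row i h, smul_mul_assoc, mul_assoc]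

theorem col_assoc (H : IsQuantumMatrix_s8 p t) (a : J) {i k : I} (h : i < k) (z : A) :
    t k a * (t i a * z) = p⁻¹ • (t i a * (t k a * z)) := by
  rw [← mul_assoc, H.col a h, smul_mul_assoc, mul_assoc]

theorem anti_assoc (H : IsQuantumMatrix_s8 p t) {i k : I} {a b : J} (h : i < k) (h' : a < b) (z : A) :
    t k a * (t i b * z) = t i b * (t k a * z) := by
  rw [← mul_assoc, H.anti h h', mul_assoc]

theorem main_assoc (H : IsQuantumMatrix_s8 p t) {i k : I} {a b : J} (h : i < k) (h' : a < b) (z : A) :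
    t k b * (t i a * z) = t i a * (t k b * z) - (p - p⁻¹) • (t i b * (t k a * z)) := by
  rw [← mul_assoc, H.main h h', sub_mul, smul_mul_assoc, mul_assoc, mul_assoc]

variable [Fintype J] [CharZero F]

/-- The quadratic relations among the `x_{ij}` involving exactly two different rows. -/
theorem symGen_relations_two (H : IsQuantumMatrix_s8 p t) (hp : p ≠ 0) {i j : I} (h1 : i < j) :
    (symGen t i j * symGen t i i =
      p ^ (-2 : ℤ) • (symGen t i i * symGen t i j)) ∧
    (symGen t j j * symGen t i j =
      p ^ (-2 : ℤ) • (symGen t i j * symGen t j j)) ∧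
    (symGen t j j * symGen t i i =
      symGen t i i * symGen t j j - (p⁻¹ * (p ^ (2 : ℤ) - p ^ (-2 : ℤ))) •
        (symGen t i j * symGen t i j)) := by
  refine ⟨?_, ?_, ?_⟩
  all_goals
    rw [← sub_eq_zero]
    simp only [symGen, Finset.sum_mul_sum, Finset.smul_sum,
      ← Finset.sum_sub_distrib]
    refine sum_sum_eq_zero_of_symm F _ (fun a => ?_) fun a b hab => ?_
    all_goals
      simp (disch := assumption) only [mul_assoc, H.row, H.col, H.anti, H.main, H.row_assoc,
        H.col_assoc, H.anti_assoc, H.main_assoc, mul_smul_comm, mul_sub, smul_sub, smul_smul]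
      match_scalars <;> field_simp <;> ring

/-- The quadratic relations among the `x_{ij}` involving exactly three different rows. -/
theorem symGen_relations_three (H : IsQuantumMatrix_s8 p t) (hp : p ≠ 0) {i j k : I}
    (h1 : i < j) (h2 : j < k) :
    (symGen t i k * symGen t i j =
      p⁻¹ • (symGen t i j * symGen t i k)) ∧
    (symGen t j k * symGen t i k =
      p⁻¹ • (symGen t i k * symGen t j k)) ∧
    (symGen t j k * symGen t i j =
      p⁻¹ • (symGen t i j * symGen t j k) - (p - p⁻¹) • (symGen t i k * symGen t j j)) ∧
    (symGen t j k * symGen t i i =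
      symGen t i i * symGen t j k - (p ^ (2 : ℤ) - p ^ (-2 : ℤ)) •
        (symGen t i k * symGen t i j)) ∧
    (symGen t k k * symGen t i j =
      symGen t i j * symGen t k k - (p⁻¹ * (p ^ (2 : ℤ) - p ^ (-2 : ℤ))) •
        (symGen t i k * symGen t j k)) ∧
    (symGen t j j * symGen t i k =
      symGen t i k * symGen t j j) := by
  have := h1.trans h2
  refine ⟨?_, ?_, ?_, ?_, ?_, ?_⟩
  all_goals
    rw [← sub_eq_zero]
    simp only [symGen, Finset.sum_mul_sum, Finset.smul_sum,
      ← Finset.sum_sub_distrib]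
    refine sum_sum_eq_zero_of_symm F _ (fun a => ?_) fun a b hab => ?_
    all_goals
      simp (disch := assumption) only [mul_assoc, H.row, H.col, H.anti, H.main, H.row_assoc,
        H.col_assoc, H.anti_assoc, H.main_assoc, mul_smul_comm, mul_sub, smul_sub, smul_smul]
      match_scalars <;> field_simp <;> ring

/-- The quadratic relations among the `x_{ij}` involving exactly four different rows. -/
theorem symGen_relations_four (H : IsQuantumMatrix_s8 p t) (hp : p ≠ 0) {i j k l : I}
    (h1 : i < j) (h2 : j < k) (h3 : k < l) :
    (symGen t j l * symGen t i k =
      symGen t i k * symGen t j l - (p - p⁻¹) • (symGen t i l * symGen t j k)) ∧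
    (symGen t k l * symGen t i j =
      symGen t i j * symGen t k l - (p - p⁻¹) •
        (p⁻¹ • (symGen t i l * symGen t j k) + symGen t i k * symGen t j l)) ∧
    (symGen t j k * symGen t i l =
      symGen t i l * symGen t j k) := by
  have h12 := h1.trans h2
  have := h2.trans h3
  have := h12.trans h3
  refine ⟨?_, ?_, ?_⟩
  all_goals
    rw [← sub_eq_zero]
    simp only [symGen, Finset.sum_mul_sum, Finset.smul_sum, ← Finset.sum_add_distrib,
      ← Finset.sum_sub_distrib]
    refine sum_sum_eq_zero_of_symm F _ (fun a => ?_) fun a b hab => ?_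
    all_goals
      simp (disch := assumption) only [mul_assoc, H.col, H.anti, H.main,
        H.col_assoc, H.anti_assoc, H.main_assoc, mul_smul_comm, mul_sub, smul_sub, smul_smul]
      match_scalars <;> field_simp <;> ring

end IsQuantumMatrix_s8

theorem isQuantumMatrix_tGen_s8 (n : ℕ) : IsQuantumMatrix_s8 q (tGen (n := n)) where
  row i a b h := by
    have := RingQuot.mkAlgHom_rel K (matRel.rowq i a b h)
    simp only [map_mul, map_smul] at this
    rw [eq_inv_smul_iff₀ q_ne_zero]
    exact this.symm
  col a i k h := by
    have := RingQuot.mkAlgHom_rel K (matRel.colq a i k h)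
    simp only [map_mul, map_smul] at this
    rw [eq_inv_smul_iff₀ q_ne_zero]
    exact this.symm
  anti {i k a b} h h' := by
    have := RingQuot.mkAlgHom_rel K (matRel.anti i k a b h h')
    simp only [map_mul] at this
    exact this.symm
  main {i k a b} h h' := by
    have h1 := RingQuot.mkAlgHom_rel K (matRel.main i k a b h h')
    have h2 := RingQuot.mkAlgHom_rel K (matRel.anti i k a b h h')
    simp only [map_mul, map_add, map_smul] at h1 h2
    rw [← h2] at h1
    exact eq_sub_of_add_eq h1.symm

theorem stmt8 (n : ℕ) (l h d kk : Fin n) :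
    (d = l → l = kk → kk < h →
      xAI l h * xAI d kk = (q ^ (-2 : ℤ)) • (xAI d kk * xAI l h)) ∧
    (d = l → l < kk → kk < h →
      xAI l h * xAI d kk = q⁻¹ • (xAI d kk * xAI l h)) ∧
    (d < l → l = kk → kk = h →
      xAI l h * xAI d kk = (q ^ (-2 : ℤ)) • (xAI d kk * xAI l h)) ∧
    (d < l → l < kk → kk = h →
      xAI l h * xAI d kk = q⁻¹ • (xAI d kk * xAI l h)) ∧
    (d < l → l = kk → kk < h →
      xAI l h * xAI d kk = q⁻¹ • (xAI d kk * xAI l h) - (q - q⁻¹) • (xAI d h * xAI l kk)) ∧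
    (d < l → l < kk → kk < h →
      xAI l h * xAI d kk = xAI d kk * xAI l h - (q - q⁻¹) • (xAI d h * xAI l kk)) ∧
    (d = kk → kk < l → l = h →
      xAI l h * xAI d kk =
        xAI d kk * xAI l h - (q⁻¹ * (q ^ (2 : ℤ) - q ^ (-2 : ℤ))) • (xAI d h * xAI kk l)) ∧
    (d = kk → kk < l → l < h →
      xAI l h * xAI d kk =
        xAI d kk * xAI l h - (q ^ (2 : ℤ) - q ^ (-2 : ℤ)) • (xAI d h * xAI kk l)) ∧
    (d < kk → kk < l → l = h →
      xAI l h * xAI d kk =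
        xAI d kk * xAI l h - (q⁻¹ * (q ^ (2 : ℤ) - q ^ (-2 : ℤ))) • (xAI d h * xAI kk l)) ∧
    (d < kk → kk < l → l < h →
      xAI l h * xAI d kk =
        xAI d kk * xAI l h - (q - q⁻¹) • (q⁻¹ • (xAI d h * xAI kk l) + xAI d l * xAI kk h)) ∧
    (d < l → l < h → h < kk →
      xAI l h * xAI d kk = xAI d kk * xAI l h) ∧
    (d < l → l = h → h < kk →
      xAI l h * xAI d kk = xAI d kk * xAI l h) := by
  have H := isQuantumMatrix_tGen_s8 n
  refine ⟨?_, ?_, ?_, ?_, ?_, ?_, ?_, ?_, ?_, ?_, ?_, ?_⟩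
  · rintro rfl rfl h1
    exact (H.symGen_relations_two q_ne_zero h1).1
  · rintro rfl h1 h2
    exact (H.symGen_relations_three q_ne_zero h1 h2).1
  · rintro h1 rfl rfl
    exact (H.symGen_relations_two q_ne_zero h1).2.1
  · rintro h1 h2 rfl
    exact (H.symGen_relations_three q_ne_zero h1 h2).2.1
  · rintro h1 rfl h2
    exact (H.symGen_relations_three q_ne_zero h1 h2).2.2.1
  · rintro h1 h2 h3
    exact (H.symGen_relations_four q_ne_zero h1 h2 h3).1
  · rintro rfl h1 rfl
    exact (H.symGen_relations_two q_ne_zero h1).2.2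
  · rintro rfl h1 h2
    exact (H.symGen_relations_three q_ne_zero h1 h2).2.2.2.1
  · rintro h1 h2 rfl
    exact (H.symGen_relations_three q_ne_zero h1 h2).2.2.2.2.1
  · rintro h1 h2 h3
    exact (H.symGen_relations_four q_ne_zero h1 h2 h3).2.1
  · rintro h1 h2 h3
    exact (H.symGen_relations_four q_ne_zero h1 h2 h3).2.2
  · rintro h1 rfl h2
    exact (H.symGen_relations_three q_ne_zero h1 h2).2.2.2.2.2
end
end
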